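/- Let K be an n×n real symmetric positive definite matrix, f ∈ ℝⁿ, u* := K⁻¹f, and let j: ℝⁿ → ℝ be twice continuously differentiable. Let λ* ∈ ℝⁿ solve K λ* = ∇j(u*) (the exact adjoint), let u_k ∈ ℝⁿ be arbitrary, and let λ_k ∈ ℝⁿ be arbitrary. Define the primal residual r(w) := K w − f, the adjoint residual r^adj(v) := K v − ∇j(u_k), and the matrix A := K^{-1/2} [∫₀¹ ∇²j(θ u* + (1−θ) u_k) dθ] K⁻¹. Then the energy norm of the adjoint error is bounded by ‖λ* − λ_k‖_K ≤ σ_min(K)^{-1/2} ‖r^adj(λ_k)‖₂ + σ_max(A) ‖r(u_k)‖₂. -/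

import Mathlib

open Matrix

/-- Euclidean (ℓ²) norm of a vector in `ℝⁿ`. -/
noncomputable def l2norm {n : ℕ} (v : Fin n → ℝ) : ℝ :=
  ‖(WithLp.equiv 2 (Fin n → ℝ)).symm v‖

/-- Energy norm `‖w‖_K = √(wᵀ K w)` induced by a matrix `K`. -/
noncomputable def energyNorm {n : ℕ} (K : Matrix (Fin n) (Fin n) ℝ) (w : Fin n → ℝ) : ℝ :=
  Real.sqrt (w ⬝ᵥ K.mulVec w)

/-- Smallest singular value of a symmetric positive definite matrix,
equal to its smallest eigenvalue. -/
noncomputable def sigmaMin {n : ℕ} (K : Matrix (Fin n) (Fin n) ℝ) (hK : K.IsHermitian) : ℝ :=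
  ⨅ i, hK.eigenvalues i

/-- Largest singular value of a (rectangular) matrix: the operator norm of the induced
linear map between Euclidean spaces. -/
noncomputable def sigmaMax {m n : ℕ} (A : Matrix (Fin m) (Fin n) ℝ) : ℝ :=
  ‖LinearMap.toContinuousLinearMap (Matrix.toEuclideanLin A)‖

lemma l2norm_neg {n : ℕ} (v : Fin n → ℝ) : l2norm (-v) = l2norm v := by
  simp [l2norm]

lemma l2norm_add_le {n : ℕ} (v w : Fin n → ℝ) : l2norm (v + w) ≤ l2norm v + l2norm w := by
  simpa [l2norm] using norm_add_le (WithLp.toLp 2 v) (WithLp.toLp 2 w)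

lemma l2norm_eq_sqrt_dotProduct {n : ℕ} (v : Fin n → ℝ) : l2norm v = Real.sqrt (v ⬝ᵥ v) := by
  simp [l2norm, EuclideanSpace.norm_eq, dotProduct, sq]

lemma l2norm_mulVec_le_sigmaMax {m n : ℕ} (A : Matrix (Fin m) (Fin n) ℝ) (v : Fin n → ℝ) :
    l2norm (A.mulVec v) ≤ sigmaMax A * l2norm v :=
  (LinearMap.toContinuousLinearMap (Matrix.toEuclideanLin A)).le_opNorm (WithLp.toLp 2 v)

lemma dotProduct_sq_mulVec {n : ℕ} {S : Matrix (Fin n) (Fin n) ℝ} (hS : S.IsHermitian)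
    (w : Fin n → ℝ) : w ⬝ᵥ (S * S).mulVec w = S.mulVec w ⬝ᵥ S.mulVec w := by
  have hT : Sᵀ = S := by simpa [IsHermitian] using hS
  rw [← mulVec_mulVec, dotProduct_mulVec, ← mulVec_transpose, hT]

lemma energyNorm_sq {n : ℕ} {S : Matrix (Fin n) (Fin n) ℝ} (hS : S.IsHermitian)
    (w : Fin n → ℝ) : energyNorm (S * S) w = l2norm (S.mulVec w) := by
  rw [energyNorm, dotProduct_sq_mulVec hS, l2norm_eq_sqrt_dotProduct]

/-- The Rayleigh quotient of a Hermitian matrix is at least its smallest eigenvalue. -/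
lemma sigmaMin_mul_dotProduct_le {n : ℕ} {K : Matrix (Fin n) (Fin n) ℝ} (hK : K.IsHermitian)
    (w : Fin n → ℝ) : sigmaMin K hK * (w ⬝ᵥ w) ≤ w ⬝ᵥ K.mulVec w := by
  let b := hK.eigenvectorBasis
  have key (x y : Fin n → ℝ) : x ⬝ᵥ y =
      ∑ i, inner ℝ (b i) (WithLp.toLp 2 x) * inner ℝ (b i) (WithLp.toLp 2 y) := by
    have h := b.sum_inner_mul_inner (WithLp.toLp 2 x) (WithLp.toLp 2 y)
    simp only [real_inner_comm] at h ⊢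
    rw [h]
    simp [EuclideanSpace.inner_eq_star_dotProduct, dotProduct_comm]
  have hT : Kᵀ = K := by simpa [IsHermitian] using hK
  have hb (i : Fin n) : inner ℝ (b i) (WithLp.toLp 2 (K.mulVec w)) =
      hK.eigenvalues i * inner ℝ (b i) (WithLp.toLp 2 w) := by
    have h := hK.mulVec_eigenvectorBasis i
    simp only [EuclideanSpace.inner_eq_star_dotProduct, star_trivial]
    rw [dotProduct_comm, dotProduct_mulVec, ← mulVec_transpose, hT, h, smul_dotProduct,
      dotProduct_comm]
    rfl
  rw [key, key, Finset.mul_sum]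
  refine Finset.sum_le_sum fun i _ => ?_
  rw [hb, mul_left_comm (inner ℝ (b i) _)]
  exact mul_le_mul_of_nonneg_right (ciInf_le (Set.finite_range _).bddBelow i)
    (mul_self_nonneg _)

lemma sigmaMin_pos {n : ℕ} [NeZero n] {K : Matrix (Fin n) (Fin n) ℝ} (hK : K.PosDef) :
    0 < sigmaMin K hK.isHermitian := by
  obtain ⟨i, hi⟩ := exists_eq_ciInf_of_finite (f := hK.isHermitian.eigenvalues)
  rw [sigmaMin, ← hi]
  exact hK.eigenvalues_pos i

lemma l2norm_le_of_sq_posDef {n : ℕ} {K S : Matrix (Fin n) (Fin n) ℝ} (hK : K.PosDef)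
    (hS : S.IsHermitian) (hSS : S * S = K) (w : Fin n → ℝ) :
    l2norm w ≤ Real.sqrt (sigmaMin K hK.isHermitian)⁻¹ * l2norm (S.mulVec w) := by
  rcases Nat.eq_zero_or_pos n with rfl | hn
  · simp [l2norm_eq_sqrt_dotProduct]
  · have : NeZero n := ⟨hn.ne'⟩
    have hpos := sigmaMin_pos hK
    rw [l2norm_eq_sqrt_dotProduct, l2norm_eq_sqrt_dotProduct,
      ← Real.sqrt_mul (inv_nonneg.2 hpos.le)]
    refine Real.sqrt_le_sqrt ?_
    rw [← dotProduct_sq_mulVec hS, hSS, le_inv_mul_iff₀ hpos]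
    exact sigmaMin_mul_dotProduct_le hK.isHermitian w

lemma contDiff_gradient {n : ℕ} {j : (Fin n → ℝ) → ℝ} (hj : ContDiff ℝ 2 j)
    {G : (Fin n → ℝ) → (Fin n → ℝ)} (hG : ∀ u v, fderiv ℝ j u v = G u ⬝ᵥ v) :
    ContDiff ℝ 1 G := by
  rw [contDiff_pi]
  intro i
  have h : (fun u => G u i) = fun u => fderiv ℝ j u (Pi.single i 1) := by
    funext u
    simp [hG]
  rw [h]
  exact (hj.fderiv_right (m := 1) (by norm_num)).clm_apply contDiff_const

/-- Mean value identity: the averaged Jacobian along a segment maps the increment of the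
argument to the increment of the function. -/
lemma integral_jacobian_mulVec_sub {n : ℕ} {G : (Fin n → ℝ) → (Fin n → ℝ)}
    (hGc : ContDiff ℝ 1 G) {H : (Fin n → ℝ) → Matrix (Fin n) (Fin n) ℝ}
    (hH : ∀ u v, fderiv ℝ G u v = (H u).mulVec v) (a b : Fin n → ℝ) :
    (Matrix.of fun p q => ∫ θ in (0:ℝ)..1, H (θ • b + (1 - θ) • a) p q).mulVec (b - a) =
      G b - G a := by
  have hHc (p q : Fin n) : Continuous fun θ : ℝ => H (θ • b + (1 - θ) • a) p q := by
    have h : (fun θ : ℝ => H (θ • b + (1 - θ) • a) p q) =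
        fun θ : ℝ => fderiv ℝ G (θ • b + (1 - θ) • a) (Pi.single q 1) p := by
      funext θ
      simp [hH]
    have hf := hGc.continuous_fderiv one_ne_zero
    rw [h]
    fun_prop
  have hd (p : Fin n) (θ : ℝ) : HasDerivAt (fun θ : ℝ => G (θ • b + (1 - θ) • a) p)
      (∑ q, H (θ • b + (1 - θ) • a) p q * (b - a) q) θ := by
    have hl : HasDerivAt (fun θ : ℝ => θ • b + (1 - θ) • a) (b - a) θ := by
      have h := ((hasDerivAt_id θ).smul_const b).add
        (((hasDerivAt_id θ).const_sub 1).smul_const a)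
      exact h.congr_deriv (by simp [sub_eq_add_neg])
    have hc := ((hGc.differentiable one_ne_zero _).hasFDerivAt).comp_hasDerivAt θ hl
    rw [hH] at hc
    exact hasDerivAt_pi.1 hc p
  funext p
  have hint (q : Fin n) : IntervalIntegrable
      (fun θ : ℝ => H (θ • b + (1 - θ) • a) p q * (b - a) q) MeasureTheory.volume 0 1 :=
    ((hHc p q).mul continuous_const).intervalIntegrable 0 1
  have hftc := intervalIntegral.integral_eq_sub_of_hasDerivAt (a := 0) (b := 1)
    (fun θ _ => hd p θ)
    ((continuous_finsetSum _ fun q _ => (hHc p q).mul continuous_const).intervalIntegrable 0 1)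
  rw [intervalIntegral.integral_finsetSum fun q _ => hint q] at hftc
  simp only [intervalIntegral.integral_mul_const] at hftc
  simpa [mulVec, dotProduct] using hftc

/-- adjoint error bound.  `K` SPD with SPD square root `S` (`S * S = K`),
`u* = K⁻¹ f`, `j` twice continuously differentiable with gradient `G` and Hessian `H`,
`λ*` the exact adjoint (`K λ* = ∇j(u*)`), `u_k, λ_k` arbitrary.  With the primal residual
`r(w) = K w − f`, adjoint residual `r^adj(v) = K v − ∇j(u_k)`, and
`A = K^{-1/2} [∫₀¹ ∇²j(θu* + (1−θ)u_k) dθ] K⁻¹`, the energy norm of the adjoint error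
satisfies `‖λ* − λ_k‖_K ≤ σ_min(K)^{-1/2} ‖r^adj(λ_k)‖₂ + σ_max(A) ‖r(u_k)‖₂`. -/
theorem stmt5 {n : ℕ} (K : Matrix (Fin n) (Fin n) ℝ) (hK : K.PosDef)
    (S : Matrix (Fin n) (Fin n) ℝ) (hS : S.PosDef) (hSS : S * S = K)
    (f : Fin n → ℝ)
    (j : (Fin n → ℝ) → ℝ) (hj : ContDiff ℝ 2 j)
    (G : (Fin n → ℝ) → (Fin n → ℝ))
    (hG : ∀ u v : Fin n → ℝ, fderiv ℝ j u v = G u ⬝ᵥ v)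
    (H : (Fin n → ℝ) → Matrix (Fin n) (Fin n) ℝ)
    (hH : ∀ u v : Fin n → ℝ, fderiv ℝ G u v = (H u).mulVec v)
    (ustar lamstar uk lamk : Fin n → ℝ)
    (hustar : ustar = K⁻¹.mulVec f)
    (hlamstar : K.mulVec lamstar = G ustar)
    (A : Matrix (Fin n) (Fin n) ℝ)
    (hA : A = S⁻¹ *
      (Matrix.of fun p q => ∫ θ in (0:ℝ)..1, H (θ • ustar + (1 - θ) • uk) p q) * K⁻¹) :
    energyNorm K (lamstar - lamk) ≤
      Real.sqrt (sigmaMin K hK.isHermitian)⁻¹ * l2norm (K.mulVec lamk - G uk)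
        + sigmaMax A * l2norm (K.mulVec uk - f) := by
  have hSu : IsUnit S.det := hS.isUnit.map Matrix.detMonoidHom
  have hKu : IsUnit K.det := hK.isUnit.map Matrix.detMonoidHom
  have hmean := integral_jacobian_mulVec_sub (contDiff_gradient hj hG) hH uk ustar
  set M : Matrix (Fin n) (Fin n) ℝ :=
    Matrix.of fun p q => ∫ θ in (0:ℝ)..1, H (θ • ustar + (1 - θ) • uk) p q
  have hres : K⁻¹.mulVec (K.mulVec uk - f) = -(ustar - uk) := by
    rw [mulVec_sub, mulVec_mulVec, nonsing_inv_mul K hKu, one_mulVec, ← hustar, neg_sub]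
  have hAr : A.mulVec (K.mulVec uk - f) = -S⁻¹.mulVec (G ustar - G uk) := by
    rw [hA, ← mulVec_mulVec, hres, ← mulVec_mulVec, mulVec_neg, hmean, mulVec_neg]
  have herr : S.mulVec (lamstar - lamk) =
      -(S⁻¹.mulVec (K.mulVec lamk - G uk) + A.mulVec (K.mulVec uk - f)) := by
    have h : S.mulVec (lamstar - lamk) = S⁻¹.mulVec (K.mulVec (lamstar - lamk)) := by
      rw [mulVec_mulVec, ← hSS, nonsing_inv_mul_cancel_left S S hSu]
    rw [h, hAr, mulVec_sub K, hlamstar, ← sub_eq_add_neg, ← mulVec_sub, ← mulVec_neg]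
    congr 1
    abel
  have hadj := l2norm_le_of_sq_posDef hK hS.isHermitian hSS
    (S⁻¹.mulVec (K.mulVec lamk - G uk))
  rw [mulVec_mulVec, mul_nonsing_inv S hSu, one_mulVec] at hadj
  calc energyNorm K (lamstar - lamk)
      = l2norm (S⁻¹.mulVec (K.mulVec lamk - G uk) + A.mulVec (K.mulVec uk - f)) := by
        rw [← hSS, energyNorm_sq hS.isHermitian, hSS, herr, l2norm_neg]
    _ ≤ _ := (l2norm_add_le _ _).trans
        (add_le_add hadj (l2norm_mulVec_le_sigmaMax A _))
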